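/- Let conclusions be triples in κ = Bool × Tag × Lit, let d : Tag, and for each literal q let C q be a formula whose proof atoms are pairs (d', p) : Tag × Lit, evaluated with respect to a proof P via the valuation M_P s (d', p) := ((s, d', p) ∈ P). Suppose the inference system satisfies, for all q and P: Rule (true, d, q) P ↔ eval (C q) under (M_P, v) and Rule (false, d, q) P ↔ eval (sneg (C q)) under (M_P, v) (the logic supports the Principle of Strong Negation for d), and suppose the system is stable. Then d is coherent — there is no literal q with both (true, d, q) and (false, d, q) derivable — if and only if there is no literal q and proof P such that both C q and sneg (C q) evaluate to true under (M_P, v). -/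

import Mathlib

inductive Fml (Atom Pure I : Type) : Type
  | memP (s : Bool) (a : Atom) : Fml Atom Pure I
  | nmemP (s : Bool) (a : Atom) : Fml Atom Pure I
  | pure (p : Pure) : Fml Atom Pure I
  | npure (p : Pure) : Fml Atom Pure I
  | and (A B : Fml Atom Pure I) : Fml Atom Pure I
  | or (A B : Fml Atom Pure I) : Fml Atom Pure I
  | all (f : I → Fml Atom Pure I) : Fml Atom Pure I
  | ex (f : I → Fml Atom Pure I) : Fml Atom Pure I

namespace Fml

variable {Atom Pure I : Type}

def sneg : Fml Atom Pure I → Fml Atom Pure I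
  | memP s a => memP (!s) a
  | nmemP s a => memP s a
  | pure p => npure p
  | npure p => pure p
  | and A B => or A.sneg B.sneg
  | or A B => and A.sneg B.sneg
  | all f => ex fun i => (f i).sneg
  | ex f => all fun i => (f i).sneg

def nnfNeg : Fml Atom Pure I → Fml Atom Pure I
  | memP s a => nmemP s a
  | nmemP s a => memP s a
  | pure p => npure p
  | npure p => pure p
  | and A B => or A.nnfNeg B.nnfNeg
  | or A B => and A.nnfNeg B.nnfNeg
  | all f => ex fun i => (f i).nnfNeg
  | ex f => all fun i => (f i).nnfNeg

def PosOnly : Fml Atom Pure I → Prop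
  | memP _ _ => True
  | nmemP _ _ => False
  | pure _ => True
  | npure _ => True
  | and A B => A.PosOnly ∧ B.PosOnly
  | or A B => A.PosOnly ∧ B.PosOnly
  | all f => ∀ i, (f i).PosOnly
  | ex f => ∀ i, (f i).PosOnly

def NegOnly : Fml Atom Pure I → Prop
  | memP _ _ => False
  | nmemP _ _ => True
  | pure _ => True
  | npure _ => True
  | and A B => A.NegOnly ∧ B.NegOnly
  | or A B => A.NegOnly ∧ B.NegOnly
  | all f => ∀ i, (f i).NegOnly
  | ex f => ∀ i, (f i).NegOnly

def eval (M : Bool → Atom → Prop) (v : Pure → Prop) : Fml Atom Pure I → Prop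
  | memP s a => M s a
  | nmemP s a => ¬ M s a
  | pure p => v p
  | npure p => ¬ v p
  | and A B => A.eval M v ∧ B.eval M v
  | or A B => A.eval M v ∨ B.eval M v
  | all f => ∀ i, (f i).eval M v
  | ex f => ∃ i, (f i).eval M v

end Fml

def IsProof {κ : Type} (Rule : κ → List κ → Prop) (P : List κ) : Prop :=
  ∀ i : Fin P.length, Rule (P.get i) (P.take i.1)

def Stable {κ : Type} (Rule : κ → List κ → Prop) : Prop :=
  ∀ (c : κ) (P Q : List κ), P.Sublist Q → Rule c P → Rule c Q

def Derivable {κ : Type} (Rule : κ → List κ → Prop) (c : κ) : Prop :=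
  ∃ P, IsProof Rule P ∧ c ∈ P

section

variable {κ : Type} {Rule : κ → List κ → Prop}

theorem IsProof.append {P Q : List κ} (hP : IsProof Rule P)
    (hQ : ∀ i : Fin Q.length, Rule (Q.get i) (P ++ Q.take i.1)) : IsProof Rule (P ++ Q) := by
  rintro ⟨i, hi⟩
  rw [List.get_eq_getElem, List.take_append]
  by_cases h : i < P.length
  · simpa [List.getElem_append_left h, Nat.sub_eq_zero_of_le h.le] using hP ⟨i, h⟩
  · have hle : P.length ≤ i := not_lt.mp h
    have hlt : i - P.length < Q.length := by
      rw [List.length_append] at hi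
      omega
    simpa [List.getElem_append_right hle, List.take_of_length_le hle] using hQ ⟨i - P.length, hlt⟩

theorem IsProof.derivable {P : List κ} {c : κ} (hP : IsProof Rule P) (hc : Rule c P) :
    Derivable Rule c :=
  ⟨P ++ [c], hP.append fun i => by simpa using hc, by simp⟩

theorem Stable.isProof_append (h : Stable Rule) {P Q : List κ} (hP : IsProof Rule P)
    (hQ : IsProof Rule Q) : IsProof Rule (P ++ Q) :=
  hP.append fun i => h _ _ _ (List.sublist_append_right _ _) (hQ i)

theorem Stable.rule_of_mem (h : Stable Rule) {P Q : List κ} {c : κ} (hP : IsProof Rule P)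
    (hc : c ∈ P) (hPQ : P.Sublist Q) : Rule c Q := by
  obtain ⟨i, rfl⟩ := List.get_of_mem hc
  exact h _ _ _ ((List.take_sublist _ _).trans hPQ) (hP i)

end

theorem coherent_iff_conjunction_proof_unsat {Tag Lit Pure I : Type}
    (Rule : (Bool × Tag × Lit) → List (Bool × Tag × Lit) → Prop)
    (v : Pure → Prop) (d : Tag)
    (C : Lit → Fml (Tag × Lit) Pure I)
    (hp : ∀ (q : Lit) (P : List (Bool × Tag × Lit)),
      Rule (true, d, q) P ↔ (C q).eval (fun s a => (s, a) ∈ P) v)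
    (hm : ∀ (q : Lit) (P : List (Bool × Tag × Lit)),
      Rule (false, d, q) P ↔ (C q).sneg.eval (fun s a => (s, a) ∈ P) v)
    (hstable : Stable Rule) :
    (¬ ∃ q, Derivable Rule (true, d, q) ∧ Derivable Rule (false, d, q)) ↔
      (¬ ∃ (q : Lit) (P : List (Bool × Tag × Lit)), IsProof Rule P ∧
        (C q).eval (fun s a => (s, a) ∈ P) v ∧
        (C q).sneg.eval (fun s a => (s, a) ∈ P) v) := by
  refine not_congr ⟨?_, ?_⟩
  · rintro ⟨q, ⟨P, hP, hqP⟩, ⟨Q, hQ, hqQ⟩⟩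
    exact ⟨q, P ++ Q, hstable.isProof_append hP hQ,
      (hp q _).mp (hstable.rule_of_mem hP hqP (List.sublist_append_left P Q)),
      (hm q _).mp (hstable.rule_of_mem hQ hqQ (List.sublist_append_right P Q))⟩
  · rintro ⟨q, P, hP, hC, hS⟩
    exact ⟨q, hP.derivable ((hp q P).mpr hC), hP.derivable ((hm q P).mpr hS)⟩
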